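/- Let G be a simple graph with vertex set {v_1,…,v_n} and let col : {1,…,n} → {1,…,k} be a coloring of its vertices. Let G' be the digraph constructed from (G, col) as described in the context. Then G contains a colorful k-clique (k pairwise adjacent vertices receiving all k colors) if and only if there exist 2k pairwise edge-disjoint paths in G', namely, for each ℓ ∈ {1,…,k}, a shortest path from s^h_ℓ to t^h_ℓ and a shortest path from s^v_ℓ to t^v_ℓ. -/

import Mathlib

/-- A walk from `s` to `t` in the digraph `(V, E)`: a nonempty list of vertices starting
at `s`, ending at `t`, with `E` holding between consecutive vertices. -/
def IsWalk {V : Type*} (E : V → V → Prop) (s t : V) (W : List V) : Prop :=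
  W ≠ [] ∧ W.head? = some s ∧ W.getLast? = some t ∧ W.Chain' E

/-- The length of a walk: the number of consecutive pairs (edges). -/
def walkLength {V : Type*} (W : List V) : ℕ := W.length - 1

/-- A path: a walk with pairwise distinct vertices. -/
def IsPath {V : Type*} (E : V → V → Prop) (s t : V) (W : List V) : Prop :=
  IsWalk E s t W ∧ W.Nodup

/-- Acyclicity: no walk of positive length starts and ends at the same vertex. -/
def IsAcyclic {V : Type*} (E : V → V → Prop) : Prop :=
  ∀ (v : V) (W : List V), IsWalk E v v W → walkLength W = 0

/-- The distance from `s` to `t`: the minimum length of a walk from `s` to `t`. -/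
noncomputable def walkDist {V : Type*} (E : V → V → Prop) (s t : V) : ℕ :=
  sInf {n | ∃ W, IsWalk E s t W ∧ walkLength W = n}

/-- A shortest path from `s` to `t`: a path from `s` to `t` of length `walkDist E s t`. -/
def IsShortestPath {V : Type*} (E : V → V → Prop) (s t : V) (W : List V) : Prop :=
  IsPath E s t W ∧ walkLength W = walkDist E s t

/-- The congestion of a vertex `v` with respect to a family of walks:
the number of members of the family containing `v`. -/
noncomputable def congestion {V : Type*} {ι : Type*} (P : ι → List V) (v : V) : ℕ :=
  Nat.card {i : ι // v ∈ P i}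

/-- The list of directed edges (consecutive pairs of vertices) of a walk. -/
def edgesOf {V : Type*} (W : List V) : List (V × V) := W.zip W.tail

/-- The base vertices of the planar-DAG construction (before merging in-vertices):
grid out-vertices `out i j`; horizontal in-vertices `hIn i j` (in row `i`, immediately
before column `j`); vertical in-vertices `vIn j i` (in column `j`, immediately before
row `i`); boundary vertices `sth i`, `tth i`, `stv j`, `ttv j`; and the demand
vertices `sh ℓ`, `th ℓ`, `sv ℓ`, `tv ℓ`. -/
inductive GridV (n k : ℕ) : Type
  | out : Fin n → Fin n → GridV n k
  | hIn : Fin n → Fin n → GridV n k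
  | vIn : Fin n → Fin n → GridV n k
  | sth : Fin n → GridV n k
  | tth : Fin n → GridV n k
  | stv : Fin n → GridV n k
  | ttv : Fin n → GridV n k
  | sh : Fin k → GridV n k
  | th : Fin k → GridV n k
  | sv : Fin k → GridV n k
  | tv : Fin k → GridV n k

/-- The edges of the planar-DAG construction (before merging in-vertices). -/
inductive GridE {n k : ℕ} (G : SimpleGraph (Fin n)) (col : Fin n → Fin k) :
    GridV n k → GridV n k → Prop
  -- horizontal structure of row `i`
  | sh_sth (ℓ : Fin k) (i : Fin n) (h : col i = ℓ) : GridE G col (.sh ℓ) (.sth i)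
  | sth_hIn (i j : Fin n) (h : (j : ℕ) = 0) : GridE G col (.sth i) (.hIn i j)
  | hIn_out (i j : Fin n) : GridE G col (.hIn i j) (.out i j)
  | out_hIn (i j j' : Fin n) (h : (j : ℕ) + 1 = (j' : ℕ)) :
      GridE G col (.out i j) (.hIn i j')
  | out_tth (i j : Fin n) (h : (j : ℕ) = n - 1) : GridE G col (.out i j) (.tth i)
  | tth_th (i : Fin n) (ℓ : Fin k) (h : col i = ℓ) : GridE G col (.tth i) (.th ℓ)
  -- vertical structure of column `j`
  | sv_stv (ℓ : Fin k) (j : Fin n) (h : col j = ℓ) : GridE G col (.sv ℓ) (.stv j)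
  | stv_vIn (j i : Fin n) (h : (i : ℕ) = 0) : GridE G col (.stv j) (.vIn j i)
  | vIn_out (j i : Fin n) : GridE G col (.vIn j i) (.out i j)
  | out_vIn (i i' j : Fin n) (h : (i : ℕ) + 1 = (i' : ℕ)) :
      GridE G col (.out i j) (.vIn j i')
  | out_ttv (i j : Fin n) (h : (i : ℕ) = n - 1) : GridE G col (.out i j) (.ttv j)
  | ttv_tv (j : Fin n) (ℓ : Fin k) (h : col j = ℓ) : GridE G col (.ttv j) (.tv ℓ)

/-- The merging relation: the horizontal in-vertex of row `i` before column `j` is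
identified with the vertical in-vertex of column `j` before row `i` for `i ≠ j`,
unless `v i` and `v j` are adjacent in `G` and differ in color. -/
def MergeRel {n k : ℕ} (G : SimpleGraph (Fin n)) (col : Fin n → Fin k) :
    GridV n k → GridV n k → Prop :=
  fun x y => ∃ i j : Fin n, i ≠ j ∧ ¬ (G.Adj i j ∧ col i ≠ col j) ∧
    x = GridV.hIn i j ∧ y = GridV.vIn j i

/-- The vertex set of the planar-DAG construction `G'`: base vertices modulo merging. -/
def PlanarV (n k : ℕ) (G : SimpleGraph (Fin n)) (col : Fin n → Fin k) : Type :=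
  Quot (MergeRel G col)

/-- The edge relation of the planar-DAG construction `G'`. -/
def PlanarE {n k : ℕ} (G : SimpleGraph (Fin n)) (col : Fin n → Fin k) :
    PlanarV n k G col → PlanarV n k G col → Prop :=
  fun a b => ∃ x y : GridV n k,
    Quot.mk (MergeRel G col) x = a ∧ Quot.mk (MergeRel G col) y = b ∧ GridE G col x y

section Walks

variable {V : Type*} {E : V → V → Prop}

theorem isWalk_singleton (t : V) : IsWalk E t t [t] :=
  ⟨by simp, rfl, rfl, List.isChain_singleton t⟩

theorem IsWalk.cons {a b t : V} {W : List V} (hab : E a b) (hW : IsWalk E b t W) :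
    IsWalk E a t (a :: W) := by
  obtain ⟨-, hb, ht, hc⟩ := hW
  cases W with
  | nil => simp at hb
  | cons c W =>
    obtain rfl : c = b := by simpa using hb
    exact ⟨by simp, rfl, by simpa using ht, List.isChain_cons_cons.2 ⟨hab, hc⟩⟩

theorem IsWalk.eq_singleton_or_cons {a t : V} {W : List V} (hW : IsWalk E a t W) :
    (a = t ∧ W = [a]) ∨ ∃ b W', E a b ∧ IsWalk E b t W' ∧ W = a :: W' := by
  obtain ⟨-, ha, ht, hc⟩ := hW
  match W with
  | [] => simp at ha
  | [c] => left; simp_all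
  | c :: d :: W =>
    right
    obtain rfl : c = a := by simpa using ha
    obtain ⟨hcd, hc⟩ := List.isChain_cons_cons.1 hc
    exact ⟨d, d :: W, hcd, ⟨by simp, rfl, by simpa using ht, hc⟩, rfl⟩

theorem IsWalk.walkLength_cons {a b t : V} {W : List V} (hW : IsWalk E b t W) :
    walkLength (a :: W) = walkLength W + 1 := by
  have := List.length_pos_of_ne_nil hW.1
  simp only [walkLength, List.length_cons]
  omega

theorem IsWalk.edgesOf_cons {a b t : V} {W : List V} (hW : IsWalk E b t W) :
    edgesOf (a :: W) = (a, b) :: edgesOf W := by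
  obtain ⟨-, hb, -, -⟩ := hW
  cases W with
  | nil => simp at hb
  | cons c W =>
    obtain rfl : c = b := by simpa using hb
    simp [edgesOf]

theorem edgesOf_map {V' : Type*} (g : V → V') (W : List V) :
    edgesOf (W.map g) = (edgesOf W).map (Prod.map g g) := by
  simp [edgesOf, ← List.map_tail, List.zip_map]

theorem rel_of_mem_edgesOf {W : List V} (hW : W.IsChain E) {e : V × V}
    (he : e ∈ edgesOf W) : E e.1 e.2 ∧ e.1 ∈ W ∧ e.2 ∈ W := by
  induction W with
  | nil => simp [edgesOf] at he
  | cons a W ih =>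
    cases W with
    | nil => simp [edgesOf] at he
    | cons b W =>
      obtain ⟨hab, hc⟩ := List.isChain_cons_cons.1 hW
      have he' : e = (a, b) ∨ e ∈ edgesOf (b :: W) := by
        simpa [edgesOf] using he
      rcases he' with rfl | he'
      · simp [hab]
      · obtain ⟨h1, h2, h3⟩ := ih hc he'
        exact ⟨h1, List.mem_cons_of_mem _ h2, List.mem_cons_of_mem _ h3⟩

theorem IsWalk.nodup_of_rank {s t : V} {W : List V} (r : V → ℕ)
    (hr : ∀ a b, E a b → r a < r b) (hW : IsWalk E s t W) : W.Nodup := by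
  have hc : W.IsChain (fun a b => r a < r b) := hW.2.2.2.imp hr
  have : IsTrans V (fun a b => r a < r b) := ⟨fun _ _ _ h h' => h.trans h'⟩
  exact (List.isChain_iff_pairwise.1 hc).imp fun h h' => by simp [h'] at h

theorem IsWalk.walkDist_le {s t : V} {W : List V} (hW : IsWalk E s t W) :
    walkDist E s t ≤ walkLength W :=
  Nat.sInf_le ⟨W, hW, rfl⟩

theorem IsWalk.walkDist_eq {s t : V} {W : List V} (hW : IsWalk E s t W)
    (hmin : ∀ W', IsWalk E s t W' → walkLength W ≤ walkLength W') :
    walkDist E s t = walkLength W := by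
  refine le_antisymm hW.walkDist_le (le_csInf ⟨_, W, hW, rfl⟩ ?_)
  rintro _ ⟨W', hW', rfl⟩
  exact hmin W' hW'

theorem IsWalk.map {g : V → V} (hg : ∀ a b, E a b → E (g a) (g b)) {s t : V}
    {W : List V} (hW : IsWalk E s t W) : IsWalk E (g s) (g t) (W.map g) := by
  obtain ⟨hne, hs, ht, hc⟩ := hW
  refine ⟨by simpa using hne, by simp [hs], by simp [ht], ?_⟩
  exact (List.isChain_map g).2 (hc.imp hg)

theorem IsShortestPath.map {g : V → V} (hg : ∀ a b, E a b → E (g a) (g b))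
    (hinv : Function.Involutive g) {s t : V} {W : List V}
    (hW : IsShortestPath E s t W) : IsShortestPath E (g s) (g t) (W.map g) := by
  have hw := hW.1.1.map hg
  refine ⟨⟨hw, hW.1.2.map hinv.injective⟩, (hw.walkDist_eq fun W' hW' => ?_).symm⟩
  have h := (hW'.map hg).walkDist_le
  rw [hinv s, hinv t, ← hW.2] at h
  simpa [walkLength] using h

end Walks

section Grid

variable {n k : ℕ} {G : SimpleGraph (Fin n)} {col : Fin n → Fin k}

/-- The vertex of `G'` represented by a base vertex. -/
abbrev planarMk (G : SimpleGraph (Fin n)) (col : Fin n → Fin k) (x : GridV n k) :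
    PlanarV n k G col :=
  Quot.mk (MergeRel G col) x

theorem planarMk_eq {x y : GridV n k} (h : planarMk G col x = planarMk G col y) :
    x = y ∨ MergeRel G col x y ∨ MergeRel G col y x := by
  let F : PlanarV n k G col → Prop :=
    Quot.lift (fun z => x = z ∨ MergeRel G col x z ∨ MergeRel G col z x) (by
      rintro _ _ ⟨i, j, hij, hm, rfl, rfl⟩
      apply propext
      constructor
      · rintro (rfl | ⟨i', j', h1, h2, h3, h4⟩ | ⟨i', j', h1, h2, h3, h4⟩)
        · exact Or.inr (Or.inl ⟨i, j, hij, hm, rfl, rfl⟩)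
        · simp at h4
        · simp only [GridV.hIn.injEq] at h3
          obtain ⟨rfl, rfl⟩ := h3
          exact Or.inl h4
      · rintro (rfl | ⟨i', j', h1, h2, h3, h4⟩ | ⟨i', j', h1, h2, h3, h4⟩)
        · exact Or.inr (Or.inr ⟨i, j, hij, hm, rfl, rfl⟩)
        · simp only [GridV.vIn.injEq] at h4
          obtain ⟨rfl, rfl⟩ := h4
          exact Or.inl h3
        · simp at h3)
  change F (planarMk G col y)
  rw [← h]
  exact Or.inl rfl

theorem exists_gridE_of_planarE {x : GridV n k} {b : PlanarV n k G col}
    (h : PlanarE G col (planarMk G col x) b) :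
    ∃ z, GridE G col x z ∧ planarMk G col z = b := by
  obtain ⟨y, z, hy, hz, hyz⟩ := h
  refine ⟨z, ?_, hz⟩
  rcases planarMk_eq hy with rfl | ⟨i, j, -, -, rfl, rfl⟩ | ⟨i, j, -, -, rfl, rfl⟩
  · exact hyz
  · cases hyz
    exact .vIn_out j i
  · cases hyz
    exact .hIn_out i j

theorem GridE.planarE {x y : GridV n k} (h : GridE G col x y) :
    PlanarE G col (planarMk G col x) (planarMk G col y) :=
  ⟨x, y, rfl, rfl, h⟩

/-- A rank on base vertices that strictly increases along edges. -/
def GridV.rank : GridV n k → ℕ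
  | .out i j => 2 * (i + j) + 3
  | .hIn i j => 2 * (i + j) + 2
  | .vIn j i => 2 * (i + j) + 2
  | .sth _ | .stv _ => 1
  | .tth _ | .ttv _ => 4 * n + 3
  | .sh _ | .sv _ => 0
  | .th _ | .tv _ => 4 * n + 4

/-- The rank on the vertices of `G'`. -/
def planarRank : PlanarV n k G col → ℕ :=
  Quot.lift GridV.rank (by rintro _ _ ⟨i, j, -, -, rfl, rfl⟩; rfl)

theorem planarRank_lt {a b : PlanarV n k G col} (h : PlanarE G col a b) :
    planarRank a < planarRank b := by
  obtain ⟨x, y, rfl, rfl, h⟩ := h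
  change x.rank < y.rank
  cases h <;> simp only [GridV.rank] <;> omega

/-- Transposition of the grid. -/
def GridV.transpose : GridV n k → GridV n k
  | .out i j => .out j i
  | .hIn i j => .vIn i j
  | .vIn i j => .hIn i j
  | .sth i => .stv i
  | .tth i => .ttv i
  | .stv i => .sth i
  | .ttv i => .tth i
  | .sh ℓ => .sv ℓ
  | .th ℓ => .tv ℓ
  | .sv ℓ => .sh ℓ
  | .tv ℓ => .th ℓ

/-- Transposition of `G'`. -/
def planarTranspose : PlanarV n k G col → PlanarV n k G col :=
  Quot.lift (fun x => planarMk G col x.transpose) (by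
    rintro _ _ ⟨i, j, hij, hm, rfl, rfl⟩
    exact (Quot.sound ⟨j, i, hij.symm, fun h => hm ⟨h.1.symm, h.2.symm⟩, rfl, rfl⟩).symm)

theorem planarTranspose_involutive :
    Function.Involutive (planarTranspose (G := G) (col := col)) := by
  rintro ⟨x⟩
  cases x <;> rfl

theorem planarE_transpose (a b : PlanarV n k G col) (h : PlanarE G col a b) :
    PlanarE G col (planarTranspose a) (planarTranspose b) := by
  obtain ⟨x, y, rfl, rfl, h⟩ := h
  refine GridE.planarE (x := x.transpose) (y := y.transpose) ?_
  cases h <;> constructor <;> assumption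

/-- The walk `W` towards `th ℓ`, whose first vertex lies in row `i`, ends in a row `i' ≥ i`
of color `ℓ`; its length is determined by `i' - i` and an offset `c`, and if `i' = i` then
it follows row `i` from column `m` on. -/
def EndsInRow (G : SimpleGraph (Fin n)) (col : Fin n → Fin k) (ℓ : Fin k)
    (W : List (PlanarV n k G col)) (i : Fin n) (c m : ℕ) : Prop :=
  ∃ i' : Fin n, i ≤ i' ∧ col i' = ℓ ∧ walkLength W + 2 * i + c = 2 * n + 2 * i' + 4 ∧
    (i' = i → ∀ j : Fin n, m ≤ j →
      (planarMk G col (.hIn i j), planarMk G col (.out i j)) ∈ edgesOf W)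

/-- What a walk `W` from a base vertex to `th ℓ` has to look like. -/
def WalkShape (G : SimpleGraph (Fin n)) (col : Fin n → Fin k) (ℓ : Fin k)
    (W : List (PlanarV n k G col)) : GridV n k → Prop
  | .out i j => EndsInRow G col ℓ W i (2 * j + 4) (j + 1)
  | .hIn i j => EndsInRow G col ℓ W i (2 * j + 3) j
  | .vIn j i => EndsInRow G col ℓ W i (2 * j + 3) (j + 1)
  | .sth i => EndsInRow G col ℓ W i 2 0
  | .tth i => EndsInRow G col ℓ W i (2 * n + 3) n
  | .sh ℓ' => ∃ i, col i = ℓ' ∧ EndsInRow G col ℓ W i 1 0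
  | .th ℓ' => ℓ' = ℓ ∧ walkLength W = 0
  | .ttv _ | .tv _ => False
  | .stv _ | .sv _ => True

theorem EndsInRow.cons {ℓ : Fin k} {W : List (PlanarV n k G col)} {i : Fin n}
    {b t a : PlanarV n k G col} {c m : ℕ} (hW : IsWalk (PlanarE G col) b t W)
    (h : EndsInRow G col ℓ W i (c + 1) m) : EndsInRow G col ℓ (a :: W) i c m := by
  obtain ⟨i', hi, hc, hl, he⟩ := h
  refine ⟨i', hi, hc, by rw [hW.walkLength_cons]; omega, fun h j hj => ?_⟩
  rw [hW.edgesOf_cons]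
  exact List.mem_cons_of_mem _ (he h j hj)

theorem walkShape_of_isWalk {ℓ : Fin k} {W : List (PlanarV n k G col)} {x : GridV n k}
    (hW : IsWalk (PlanarE G col) (planarMk G col x) (planarMk G col (.th ℓ)) W) :
    WalkShape G col ℓ W x := by
  induction W generalizing x with
  | nil => exact absurd rfl hW.1
  | cons a W ih =>
    rcases hW.eq_singleton_or_cons with ⟨hx, hw⟩ | ⟨b, W', hb, hW', hw⟩
    · rcases planarMk_eq hx with rfl | ⟨i, j, -, -, -, h⟩ | ⟨i, j, -, -, h, -⟩
      · rw [hw]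
        exact ⟨rfl, rfl⟩
      · simp at h
      · simp at h
    · obtain ⟨rfl, rfl⟩ := List.cons.inj hw
      obtain ⟨z, hz, rfl⟩ := exists_gridE_of_planarE hb
      have hs := ih hW'
      cases hz with
      | sh_sth ℓ' i h => exact ⟨i, h, hs.cons hW'⟩
      | sth_hIn i j h =>
        have := hs.cons (a := planarMk G col (.sth i)) hW'
        simpa [WalkShape, h] using this
      | hIn_out i j =>
        obtain ⟨i', hi, hc, hl, he⟩ := hs.cons (a := planarMk G col (.hIn i j)) hW'
        refine ⟨i', hi, hc, hl, fun h j' hj => ?_⟩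
        rcases hj.eq_or_lt with hj | hj
        · obtain rfl := Fin.ext hj
          simp [hW'.edgesOf_cons]
        · exact he h j' hj
      | out_hIn i j j' h =>
        refine EndsInRow.cons hW' ?_
        have hs' : EndsInRow G col ℓ W i (2 * j' + 3) j' := hs
        convert hs' using 1
        omega
      | out_tth i j h =>
        refine EndsInRow.cons hW' ?_
        have hs' : EndsInRow G col ℓ W i (2 * n + 3) n := hs
        convert hs' using 1 <;> omega
      | tth_th i ℓ' h =>
        obtain ⟨rfl, h0⟩ := hs
        refine ⟨i, le_rfl, h, by rw [hW'.walkLength_cons]; omega, fun _ j hj => ?_⟩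
        omega
      | sv_stv | stv_vIn => trivial
      | vIn_out j i => exact hs.cons hW'
      | out_vIn i i' j h =>
        obtain ⟨r, hr, hc, hl, -⟩ := hs
        have hr' : (i' : ℕ) ≤ r := hr
        refine ⟨r, Fin.le_def.2 (by omega), hc, by rw [hW'.walkLength_cons]; omega, ?_⟩
        rintro rfl
        omega
      | out_ttv | ttv_tv => exact hs.elim

/-- The base vertices on the straight horizontal path through row `i`. -/
def GridV.InRow (col : Fin n → Fin k) (i : Fin n) : GridV n k → Prop
  | .out i' _ | .hIn i' _ | .sth i' | .tth i' => i' = i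
  | .sh ℓ | .th ℓ => ℓ = col i
  | _ => False

theorem exists_walk_out (i : Fin n) (d : ℕ) (j : Fin n) (hd : j + d = n - 1) :
    ∃ W, IsWalk (PlanarE G col) (planarMk G col (.out i j)) (planarMk G col (.th (col i))) W ∧
      walkLength W = 2 * d + 2 ∧ ∀ v ∈ W, ∃ x, planarMk G col x = v ∧ x.InRow col i := by
  induction d generalizing j with
  | zero =>
    refine ⟨_, .cons (GridE.out_tth i j hd).planarE
      (.cons (GridE.tth_th i _ rfl).planarE (isWalk_singleton _)), rfl, ?_⟩
    intro v hv
    simp only [List.mem_cons, List.not_mem_nil, or_false] at hv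
    rcases hv with rfl | rfl | rfl <;> exact ⟨_, rfl, rfl⟩
  | succ d ih =>
    obtain ⟨W, hW, hl, hv⟩ := ih ⟨j + 1, by omega⟩ (by simp only; omega)
    have hW' := hW.cons (GridE.hIn_out (G := G) (col := col) i ⟨j + 1, by omega⟩).planarE
    refine ⟨_, hW'.cons (GridE.out_hIn i j _ rfl).planarE, ?_, ?_⟩
    · rw [hW'.walkLength_cons, hW.walkLength_cons]
      omega
    · intro v h
      simp only [List.mem_cons] at h
      rcases h with rfl | rfl | h
      exacts [⟨_, rfl, rfl⟩, ⟨_, rfl, rfl⟩, hv v h]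

theorem exists_row_walk (i : Fin n) :
    ∃ W, IsWalk (PlanarE G col) (planarMk G col (.sh (col i))) (planarMk G col (.th (col i))) W ∧
      walkLength W = 2 * n + 3 ∧ ∀ v ∈ W, ∃ x, planarMk G col x = v ∧ x.InRow col i := by
  have hn : 0 < n := i.pos
  obtain ⟨W, hW, hl, hv⟩ := exists_walk_out (G := G) (col := col) i (n - 1) ⟨0, hn⟩ (by simp)
  have h₁ := hW.cons (GridE.hIn_out (G := G) (col := col) i ⟨0, hn⟩).planarE
  have h₂ := h₁.cons (GridE.sth_hIn (G := G) (col := col) i ⟨0, hn⟩ rfl).planarE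
  refine ⟨_, h₂.cons (GridE.sh_sth _ i rfl).planarE, ?_, ?_⟩
  · rw [h₂.walkLength_cons, h₁.walkLength_cons, hW.walkLength_cons]
    omega
  · intro v h
    simp only [List.mem_cons] at h
    rcases h with rfl | rfl | rfl | h
    exacts [⟨_, rfl, rfl⟩, ⟨_, rfl, rfl⟩, ⟨_, rfl, rfl⟩, hv v h]

theorem exists_row_shortestPath (i : Fin n) :
    ∃ W, IsShortestPath (PlanarE G col)
        (planarMk G col (.sh (col i))) (planarMk G col (.th (col i))) W ∧
      ∀ v ∈ W, ∃ x, planarMk G col x = v ∧ x.InRow col i := by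
  obtain ⟨W, hW, hl, hv⟩ := exists_row_walk (G := G) (col := col) i
  refine ⟨W, ⟨⟨hW, hW.nodup_of_rank planarRank fun _ _ => planarRank_lt⟩,
    (hW.walkDist_eq fun W' hW' => ?_).symm⟩, hv⟩
  obtain ⟨r, -, r', hr, -, hl', -⟩ := walkShape_of_isWalk hW'
  have : (r : ℕ) ≤ r' := hr
  omega

theorem exists_row_of_shortestPath {ℓ : Fin k} {W : List (PlanarV n k G col)}
    (hW : IsShortestPath (PlanarE G col)
      (planarMk G col (.sh ℓ)) (planarMk G col (.th ℓ)) W) :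
    ∃ i, col i = ℓ ∧ ∀ j : Fin n,
      (planarMk G col (.hIn i j), planarMk G col (.out i j)) ∈ edgesOf W := by
  obtain ⟨i, rfl, i', hi, -, hl, he⟩ := walkShape_of_isWalk hW.1.1
  obtain ⟨W', hW', hl', -⟩ := exists_row_walk (G := G) (col := col) i
  have hle := hW'.walkDist_le
  rw [← hW.2] at hle
  have hii : i' = i := le_antisymm (Fin.le_def.2 (by omega)) hi
  exact ⟨i, rfl, fun j => he hii j (Nat.zero_le _)⟩

theorem exists_col_of_shortestPath {ℓ : Fin k} {W : List (PlanarV n k G col)}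
    (hW : IsShortestPath (PlanarE G col)
      (planarMk G col (.sv ℓ)) (planarMk G col (.tv ℓ)) W) :
    ∃ j, col j = ℓ ∧ ∀ i : Fin n,
      (planarMk G col (.vIn j i), planarMk G col (.out i j)) ∈ edgesOf W := by
  obtain ⟨j, hj, he⟩ := exists_row_of_shortestPath
    (hW.map planarE_transpose planarTranspose_involutive)
  refine ⟨j, hj, fun i => ?_⟩
  have h := he i
  rw [edgesOf_map, List.mem_map] at h
  obtain ⟨⟨a, b⟩, hab, h⟩ := h
  obtain ⟨ha, hb⟩ := Prod.mk.inj h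
  have ha' := congrArg planarTranspose ha
  have hb' := congrArg planarTranspose hb
  rw [planarTranspose_involutive] at ha' hb'
  rw [ha', hb'] at hab
  exact hab

theorem planarMk_ne_of_inRow {i i' : Fin n} (hi : col i ≠ col i') {x y : GridV n k}
    (hx : x.InRow col i) (hy : y.InRow col i') : planarMk G col x ≠ planarMk G col y := by
  intro h
  rcases planarMk_eq h with rfl | ⟨r, c, -, -, rfl, rfl⟩ | ⟨r, c, -, -, rfl, rfl⟩
  · cases x <;> simp_all [GridV.InRow]
  · exact hy
  · exact hx

theorem planarMk_eq_out_of_inRow {i j : Fin n} (hij : i = j ∨ G.Adj i j ∧ col i ≠ col j)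
    {x y : GridV n k} (hx : x.InRow col i) (hy : y.InRow col j)
    (h : planarMk G col x = planarTranspose (planarMk G col y)) :
    planarMk G col x = planarMk G col (.out i j) := by
  change planarMk G col x = planarMk G col y.transpose at h
  rcases planarMk_eq h with rfl | ⟨r, c, hrc, hm, rfl, hy'⟩ | ⟨r, c, hrc, hm, hy', rfl⟩
  · cases y <;> simp_all [GridV.InRow, GridV.transpose]
  · cases y <;> simp_all [GridV.InRow, GridV.transpose]
  · exact hx.elim

end Grid

/-- Correctness of the reduction for Theorem 3 of the paper: the colored graph
`(G, col)` contains a colorful `k`-clique iff the planar DAG `G'` admits `2k` pairwise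
edge-disjoint shortest paths, one from `sh ℓ` to `th ℓ` and one from `sv ℓ` to `tv ℓ`
for each color `ℓ`. -/
theorem colorful_clique_iff_edge_disjoint_shortest_paths
    (n k : ℕ) (G : SimpleGraph (Fin n)) (col : Fin n → Fin k) :
    (∃ f : Fin k → Fin n, (∀ ℓ, col (f ℓ) = ℓ) ∧
        ∀ ℓ ℓ', ℓ ≠ ℓ' → G.Adj (f ℓ) (f ℓ')) ↔
      (∃ Ph Pv : Fin k → List (PlanarV n k G col),
        (∀ ℓ, IsShortestPath (PlanarE G col)
            (Quot.mk _ (GridV.sh ℓ)) (Quot.mk _ (GridV.th ℓ)) (Ph ℓ)) ∧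
        (∀ ℓ, IsShortestPath (PlanarE G col)
            (Quot.mk _ (GridV.sv ℓ)) (Quot.mk _ (GridV.tv ℓ)) (Pv ℓ)) ∧
        (∀ a b : Fin k ⊕ Fin k, a ≠ b →
          ∀ e ∈ edgesOf (Sum.elim Ph Pv a), e ∉ edgesOf (Sum.elim Ph Pv b))) := by
  constructor
  · rintro ⟨f, hf, hadj⟩
    have hrow : ∀ ℓ, ∃ W, IsShortestPath (PlanarE G col)
        (planarMk G col (.sh ℓ)) (planarMk G col (.th ℓ)) W ∧
        ∀ v ∈ W, ∃ x, planarMk G col x = v ∧ x.InRow col (f ℓ) := by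
      intro ℓ
      have h := exists_row_shortestPath (G := G) (col := col) (f ℓ)
      rwa [hf ℓ] at h
    choose P hP hmem using hrow
    have hrow_row : ∀ ℓ ℓ', ℓ ≠ ℓ' → ∀ v ∈ P ℓ, v ∉ P ℓ' := by
      intro ℓ ℓ' hne v hv hv'
      obtain ⟨x, rfl, hx⟩ := hmem ℓ v hv
      obtain ⟨y, hxy, hy⟩ := hmem ℓ' _ hv'
      exact planarMk_ne_of_inRow (by rwa [hf, hf]) hx hy hxy.symm
    have hrow_col : ∀ ℓ ℓ', ∀ e ∈ edgesOf (P ℓ),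
        e ∉ edgesOf ((P ℓ').map planarTranspose) := by
      intro ℓ ℓ' e he he'
      have hij : f ℓ = f ℓ' ∨ G.Adj (f ℓ) (f ℓ') ∧ col (f ℓ) ≠ col (f ℓ') := by
        rcases eq_or_ne ℓ ℓ' with rfl | hne
        · exact Or.inl rfl
        · exact Or.inr ⟨hadj ℓ ℓ' hne, by rwa [hf, hf]⟩
      have hout : ∀ v ∈ P ℓ, v ∈ (P ℓ').map planarTranspose →
          v = planarMk G col (.out (f ℓ) (f ℓ')) := by
        intro v hv hv'
        obtain ⟨w, hw, rfl⟩ := List.mem_map.1 hv'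
        obtain ⟨x, hxv, hx⟩ := hmem ℓ _ hv
        obtain ⟨y, rfl, hy⟩ := hmem ℓ' w hw
        rw [← hxv]
        exact planarMk_eq_out_of_inRow hij hx hy hxv
      obtain ⟨hE, h₁, h₂⟩ := rel_of_mem_edgesOf (hP ℓ).1.1.2.2.2 he
      obtain ⟨-, h₁', h₂'⟩ := rel_of_mem_edgesOf
        ((hP ℓ').1.1.map planarE_transpose).2.2.2 he'
      have hlt := planarRank_lt hE
      rw [hout _ h₁ h₁', hout _ h₂ h₂'] at hlt
      exact lt_irrefl _ hlt
    refine ⟨P, fun ℓ => (P ℓ).map planarTranspose, hP,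
      fun ℓ => (hP ℓ).map planarE_transpose planarTranspose_involutive, ?_⟩
    rintro (ℓ | ℓ) (ℓ' | ℓ') hne e he he'
    · exact hrow_row ℓ ℓ' (by simpa using hne) e.1
        (rel_of_mem_edgesOf (hP ℓ).1.1.2.2.2 he).2.1
        (rel_of_mem_edgesOf (hP ℓ').1.1.2.2.2 he').2.1
    · exact hrow_col ℓ ℓ' e he he'
    · exact hrow_col ℓ' ℓ e he' he
    · simp only [Sum.elim_inr, edgesOf_map, List.mem_map] at he he'
      obtain ⟨a, ha, rfl⟩ := he
      obtain ⟨b, hb, hba⟩ := he'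
      obtain rfl := (planarTranspose_involutive.injective.prodMap
        planarTranspose_involutive.injective) hba
      exact hrow_row ℓ ℓ' (by simpa using hne) b.1
        (rel_of_mem_edgesOf (hP ℓ).1.1.2.2.2 ha).2.1
        (rel_of_mem_edgesOf (hP ℓ').1.1.2.2.2 hb).2.1
  · rintro ⟨Ph, Pv, hPh, hPv, hdisj⟩
    choose r hr hre using fun ℓ => exists_row_of_shortestPath (hPh ℓ)
    choose c hc hce using fun ℓ => exists_col_of_shortestPath (hPv ℓ)
    have hcross : ∀ ℓ ℓ', r ℓ ≠ c ℓ' → G.Adj (r ℓ) (c ℓ') ∧ col (r ℓ) ≠ col (c ℓ') := by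
      intro ℓ ℓ' hne
      by_contra hm
      refine hdisj (.inl ℓ) (.inr ℓ') (by simp) _ (hre ℓ (c ℓ')) ?_
      have heq : planarMk G col (.hIn (r ℓ) (c ℓ')) = planarMk G col (.vIn (c ℓ') (r ℓ)) :=
        Quot.sound ⟨_, _, hne, hm, rfl, rfl⟩
      rw [heq]
      exact hce ℓ' (r ℓ)
    have hrc : ∀ ℓ, r ℓ = c ℓ := fun ℓ => by
      by_contra hne
      exact (hcross ℓ ℓ hne).2 (by rw [hr, hc])
    refine ⟨r, hr, fun ℓ ℓ' hne => ?_⟩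
    rw [hrc ℓ']
    refine (hcross ℓ ℓ' fun h => hne ?_).1
    rw [← hr ℓ, h, hc]
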